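/- Let A be a unital C*-algebra of real rank zero, let B be a complex unital Banach algebra, let T : A → B be a surjective additive map with σ(Tx) = σ(x) for all x ∈ A (so T is bijective), and let S : A → B be a unital Jordan homomorphism with Sa = Ta for every self-adjoint a ∈ A. Put R = T⁻¹ ∘ S : A → A. Then (Rx + i·R(ix))² = 0 for every x ∈ A. -/

import Mathlib

section CStar

variable {A : Type*} [CStarAlgebra A]

theorem IsStarProjection.norm_le_one {p : A} (hp : IsStarProjection p) : ‖p‖ ≤ 1 := by
  have h := CStarRing.norm_star_mul_self (x := p)
  rw [hp.isSelfAdjoint.star_eq, hp.isIdempotentElem.eq] at h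
  nlinarith [norm_nonneg p]

theorem IsStarProjection.one_le_norm {p : A} (hp : IsStarProjection p) (h0 : p ≠ 0) :
    1 ≤ ‖p‖ := by
  have h := CStarRing.norm_star_mul_self (x := p)
  rw [hp.isSelfAdjoint.star_eq, hp.isIdempotentElem.eq] at h
  nlinarith [norm_pos_iff.mpr h0]

/-- Far away along the projection `q ≠ 1`, the perturbation `w + z • q` of `z • q` still has
spectrum in a bounded region whose size depends only on `w`. -/
theorem exists_mem_spectrum_add_smul_projection {q : A} (hq : IsStarProjection q) (hq1 : q ≠ 1)
    (w : A) {z : ℂ} (hz : 2 * (8 * ‖w‖ + 1) ≤ ‖z‖) :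
    ∃ l ∈ spectrum ℂ (w + z • q), ‖l‖ ≤ 8 * ‖w‖ + 1 := by
  set ρ := 8 * ‖w‖ + 1 with hρ
  have hw := norm_nonneg w
  have hρ0 : 0 < ρ := by positivity
  by_contra! hcon
  set m := w + z • q with hm
  have hres : ∀ l : ℂ, ‖l‖ ≤ ρ → l ∈ resolventSet ℂ m := fun l hl ↦ by
    by_contra h
    exact absurd hl (not_le.mpr (hcon l h))
  have hp : IsStarProjection (1 - q) := hq.one_sub
  have hp1 := hp.one_le_norm (sub_ne_zero.mpr hq1.symm)
  have hqq := hq.isIdempotentElem.eq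
  have hG : ∀ l : ℂ, ‖l‖ ≤ ρ → (l • (1 : A) - m) * resolvent m l = 1 := fun l hl ↦ by
    have := Ring.mul_inverse_cancel _ (hres l hl)
    rwa [← resolvent, Algebra.algebraMap_eq_smul_one] at this
  have key : ∀ l : ℂ, ‖l‖ ≤ ρ →
      (1 - q) * w * resolvent m l = l • ((1 - q) * resolvent m l) - (1 - q) := fun l hl ↦ by
    have h1 : (1 - q) * w = l • (1 - q) - (1 - q) * (l • (1 : A) - m) := by
      have : (1 - q) * (z • q) = 0 := by
        rw [mul_smul_comm, sub_mul, one_mul, hqq, sub_self, smul_zero]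
      rw [hm, mul_sub, mul_add, this, mul_smul_comm, mul_one]
      abel
    rw [h1, sub_mul, mul_assoc (1 - q), hG l hl, smul_mul_assoc, mul_one]
  have bound : ∀ l ∈ frontier (Metric.ball (0 : ℂ) ρ),
      ‖(1 - q) * w * resolvent m l‖ ≤ 1 / 2 := fun l hl ↦ by
    rw [frontier_ball _ hρ0.ne', mem_sphere_zero_iff_norm] at hl
    have hl0 : l ≠ 0 := by
      rintro rfl
      simp at hl
      linarith
    have hzl : ρ ≤ ‖l - z‖ := by
      have := norm_sub_norm_le z l
      rw [norm_sub_rev] at this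
      linarith
    have hzl0 : l - z ≠ 0 := norm_pos_iff.mp (by linarith)
    set L : A := l⁻¹ • (1 - q) + (l - z)⁻¹ • q with hL
    have hLn : ‖L‖ ≤ 2 / ρ := by
      have h1 : ‖l⁻¹ • (1 - q)‖ ≤ 1 / ρ := by
        rw [norm_smul, norm_inv, hl, one_div]
        exact mul_le_of_le_one_right (by positivity) hp.norm_le_one
      have h2 : ‖(l - z)⁻¹ • q‖ ≤ 1 / ρ := by
        rw [norm_smul, norm_inv, one_div]
        exact (mul_le_of_le_one_right (by positivity) hq.norm_le_one).trans
          (inv_anti₀ hρ0 hzl)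
      calc ‖L‖ ≤ _ := norm_add_le _ _
        _ ≤ 1 / ρ + 1 / ρ := add_le_add h1 h2
        _ = 2 / ρ := by ring
    have hLinv : L * (l • (1 : A) - z • q) = 1 := by
      have e : l • (1 : A) - z • q = l • (1 - q) + (l - z) • q := by module
      have e1 : (1 - q) * q = 0 := by rw [sub_mul, one_mul, hqq, sub_self]
      have e2 : q * (1 - q) = 0 := by rw [mul_sub, mul_one, hqq, sub_self]
      rw [e, hL, add_mul, mul_add, mul_add]
      simp only [smul_mul_smul_comm, e1, e2, hqq, hp.isIdempotentElem.eq, smul_zero,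
        inv_mul_cancel₀ hl0, inv_mul_cancel₀ hzl0, one_smul]
      abel
    have hGL : resolvent m l = L + L * (w * resolvent m l) := by
      have h1 := congrArg (L * ·) (hG l hl.le)
      have h2 : l • (1 : A) - m = (l • (1 : A) - z • q) - w := by rw [hm]; abel
      simp only [h2, sub_mul (_ - _) w, mul_sub L] at h1
      rw [← mul_assoc, hLinv, one_mul, mul_one, sub_eq_iff_eq_add] at h1
      exact h1
    have hGn : ‖w * resolvent m l‖ ≤ ‖w‖ * (2 / ρ + 2 / ρ * ‖w * resolvent m l‖) := by
      refine (norm_mul_le _ _).trans (mul_le_mul_of_nonneg_left ?_ hw)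
      conv_lhs => rw [hGL]
      refine (norm_add_le _ _).trans (add_le_add hLn ((norm_mul_le _ _).trans ?_))
      gcongr
    have hwρ : ‖w‖ * (2 / ρ) ≤ 1 / 4 := by
      rw [mul_div_assoc', div_le_iff₀ hρ0]
      linarith
    have hx := norm_nonneg (w * resolvent m l)
    have : ‖w * resolvent m l‖ ≤ 1 / 2 := by nlinarith
    rw [mul_assoc]
    exact (norm_mul_le _ _).trans (by nlinarith [hp.norm_le_one, norm_nonneg (1 - q)])
  have hdiff : DiffContOnCl ℂ (fun l ↦ (1 - q) * w * resolvent m l) (Metric.ball (0 : ℂ) ρ) := by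
    refine DifferentiableOn.diffContOnCl fun l hl ↦ ?_
    have hl' := mem_closedBall_zero_iff.mp (Metric.closure_ball_subset_closedBall hl)
    exact ((spectrum.hasDerivAt_resolvent_const_left (hres l hl')).differentiableAt.const_mul
      _).differentiableWithinAt
  have h0 := Complex.norm_le_of_forall_mem_frontier_norm_le Metric.isBounded_ball hdiff bound
    (subset_closure (Metric.mem_ball_self hρ0))
  rw [key 0 (by simpa using hρ0.le), zero_smul, zero_sub, norm_neg] at h0
  linarith

variable [PartialOrder A] [StarOrderedRing A]

open Complex in
/-- An element whose imaginary part is bounded below by a positive scalar is invertible. -/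
theorem isUnit_add_I_smul_of_le {k h : A} (hk : IsSelfAdjoint k) {δ : ℝ} (hδ : 0 < δ)
    (hh : algebraMap ℝ A δ ≤ h) : IsUnit (k + I • h) := by
  have h0 : 0 ≤ h := (algebraMap_nonneg A hδ.le).trans hh
  have hu : IsUnit h := by
    rcases subsingleton_or_nontrivial A with _ | _
    · exact isUnit_of_subsingleton h
    refine spectrum.isUnit_of_zero_notMem ℝ fun h' ↦ ?_
    have := (algebraMap_le_iff_le_spectrum (IsSelfAdjoint.of_nonneg h0)).mp hh 0 h'
    linarith
  obtain ⟨s, hs⟩ := (CFC.isUnit_sqrt_iff h h0).mpr hu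
  have hss : (s : A) * s = h := by rw [hs, CFC.sqrt_mul_sqrt_self h h0]
  have hsa : star (s : A) = s := by
    rw [hs]
    exact (IsSelfAdjoint.of_nonneg (CFC.sqrt_nonneg h)).star_eq
  have hsi : star ((s⁻¹ : Aˣ) : A) = (s⁻¹ : Aˣ) := by
    rw [← Units.coe_star_inv, show star s = s from Units.ext hsa]
  have hsak : IsSelfAdjoint ((s⁻¹ : Aˣ) * k * (s⁻¹ : Aˣ) : A) := by
    rw [IsSelfAdjoint, star_mul, star_mul, hsi, hk.star_eq, mul_assoc]
  have hunit : IsUnit ((s⁻¹ : Aˣ) * k * (s⁻¹ : Aˣ) + I • (1 : A)) := by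
    by_contra hn
    have : -I ∈ spectrum ℂ ((s⁻¹ : Aˣ) * k * (s⁻¹ : Aˣ) : A) := by
      rw [spectrum.mem_iff, Algebra.algebraMap_eq_smul_one, ← IsUnit.neg_iff]
      convert hn using 2
      module
    have := congrArg im (hsak.mem_spectrum_eq_re this)
    simp at this
  have e : k + I • h = s * ((s⁻¹ : Aˣ) * k * (s⁻¹ : Aˣ) + I • (1 : A)) * s := by
    rw [mul_add, add_mul, mul_smul_comm, smul_mul_assoc, mul_one, hss]
    simp [mul_assoc]
  rw [e]
  exact (s.isUnit.mul hunit).mul s.isUnit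

/-- Real rank zero provides a projection `1 - q ≠ 0` on which a self-adjoint element that is not
nonpositive is bounded below by a positive scalar. -/
theorem exists_isStarProjection_le_add_smul
    (hrr0 : ∀ a : A, IsSelfAdjoint a → a ∈ closure {x : A | IsSelfAdjoint x ∧ IsUnit x})
    {h : A} (hh : IsSelfAdjoint h) (hpos : ¬ h ≤ 0) :
    ∃ ε > 0, ∃ q : A, IsStarProjection q ∧ q ≠ 1 ∧
      ∃ r₀ : ℝ, ∀ r ≥ r₀, algebraMap ℝ A ε ≤ h + r • q := by
  obtain ⟨m, hm, hm0⟩ : ∃ m ∈ spectrum ℝ h, 0 < m := by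
    by_contra! hcon
    refine hpos ?_
    simpa using (le_algebraMap_iff_spectrum_le (r := (0 : ℝ)) hh).mpr hcon
  have hca : ∀ r : ℝ, IsSelfAdjoint (algebraMap ℝ A r) := fun r ↦ .algebraMap A (.all r)
  obtain ⟨g, ⟨hg, hgu⟩, hgd⟩ := Metric.mem_closure_iff.mp
    (hrr0 (h - algebraMap ℝ A (m / 2)) (hh.sub (hca _))) (m / 4) (by positivity)
  rw [dist_eq_norm] at hgd
  set d := h - algebraMap ℝ A (m / 2) - g with hd
  have hdsa : IsSelfAdjoint d := (hh.sub (hca _)).sub hg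
  have hd1 : d ≤ algebraMap ℝ A (m / 4) :=
    hdsa.le_algebraMap_norm_self.trans (algebraMap_mono A hgd.le)
  have hd2 : -algebraMap ℝ A (m / 4) ≤ d :=
    (neg_le_neg (algebraMap_mono A hgd.le)).trans hdsa.neg_algebraMap_norm_le_self
  have heq : h = algebraMap ℝ A (m / 2) + g + d := by rw [hd]; abel
  have hg0 : (0 : ℝ) ∉ spectrum ℝ g := spectrum.zero_notMem ℝ hgu
  set f : ℝ → ℝ := fun x ↦ if x < 0 then 1 else 0 with hf
  have hfc : ContinuousOn f (spectrum ℝ g) := by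
    intro x hx
    have hx0 : x ≠ 0 := fun h0 ↦ hg0 (h0 ▸ hx)
    refine ContinuousAt.continuousWithinAt ?_
    rcases lt_or_gt_of_ne hx0 with h1 | h1
    · refine (continuousAt_const (y := (1 : ℝ))).congr ?_
      filter_upwards [Iio_mem_nhds h1] with y hy
      simp [hf, Set.mem_Iio.mp hy]
    · refine (continuousAt_const (y := (0 : ℝ))).congr ?_
      filter_upwards [Ioi_mem_nhds h1] with y hy
      simp [hf, (Set.mem_Ioi.mp hy).le]
  refine ⟨m / 4, by positivity, cfc f g, ⟨?_, cfc_predicate f g⟩, ?_, ‖g‖, fun r hr ↦ ?_⟩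
  · rw [IsIdempotentElem, ← cfc_mul f f g]
    congr 1
    ext x
    simp [hf]
  · intro hq
    rw [← cfc_one ℝ g, cfc_eq_cfc_iff_eqOn hg hfc (by fun_prop)] at hq
    have hg1 : g ≤ algebraMap ℝ A 0 := by
      refine (le_algebraMap_iff_spectrum_le hg).mpr fun x hx ↦ ?_
      by_contra! hx0
      have := hq hx
      simp [hf, hx0.le] at this
    have : h ≤ algebraMap ℝ A (m / 2 + 0 + m / 4) := by
      rw [heq, map_add, map_add]
      gcongr
    have := (le_algebraMap_iff_spectrum_le hh).mp this m hm
    linarith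
  · have hpos : 0 ≤ g + r • cfc f g := by
      have : g + r • cfc f g = cfc (fun x ↦ x + r • f x) g := by
        rw [cfc_add g (fun x ↦ x) (fun x ↦ r • f x), cfc_id' ℝ g, cfc_smul r f g]
      rw [this]
      refine cfc_nonneg fun x hx ↦ ?_
      have : Nontrivial A := nontrivial_of_ne g 0 fun h0 ↦ by
        rcases subsingleton_or_nontrivial A with _ | _
        · simp [spectrum.of_subsingleton] at hx
        · exact hgu.ne_zero h0
      have hx1 := (abs_le.mp (spectrum.norm_le_norm_of_mem hx)).1
      by_cases hx0 : x < 0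
      · simp only [hf, hx0, if_true, smul_eq_mul]
        linarith
      · simpa [hf, hx0] using not_lt.mp hx0
    have h1 : algebraMap ℝ A (m / 4) = algebraMap ℝ A (m / 2) + 0 + -algebraMap ℝ A (m / 4) := by
      rw [← map_neg, add_zero, ← map_add]
      congr 1
      ring
    calc algebraMap ℝ A (m / 4) = algebraMap ℝ A (m / 2) + 0 + -algebraMap ℝ A (m / 4) := h1
      _ ≤ algebraMap ℝ A (m / 2) + (g + r • cfc f g) + d := by gcongr
      _ = h + r • cfc f g := by rw [heq]; abel


open Complex in
/-- Far away along a projection `q` in the upper half plane, the spectrum of the perturbation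
`b + z • q` of a self-adjoint `b` leaves the bounded parts of the open upper half plane. -/
theorem isUnit_algebraMap_sub_of_le_im {b q : A} (hb : IsSelfAdjoint b) (hq : IsStarProjection q)
    {ε ρ : ℝ} (hε : 0 < ε) :
    ∃ r₀ : ℝ, ∀ z : ℂ, r₀ ≤ z.im → ∀ l : ℂ, ε ≤ l.im → ‖l‖ ≤ ρ →
      IsUnit (algebraMap ℂ A l - (b + z • q)) := by
  have hqq := hq.isIdempotentElem.eq
  have hqs := hq.isSelfAdjoint.star_eq
  obtain ⟨k, hk⟩ : ∃ k : A, k = I • (q * b - b * q) := ⟨_, rfl⟩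
  have hksa : IsSelfAdjoint k := by
    rw [IsSelfAdjoint, hk, star_smul, star_sub, star_mul, star_mul, hqs, hb.star_eq, star_def,
      conj_I]
    module
  set t : ℝ := ε / 2 with ht
  have ht0 : 0 < t := by positivity
  -- `k` is off-diagonal, so it is dominated by a small multiple of `1 - q` plus a multiple of `q`
  have hkle : k ≤ t • (1 - q) + (‖k‖ ^ 2 / t) • q := by
    have h1 : 0 ≤ star (t • (1 - q) - k * q) * (t • (1 - q) - k * q) := star_mul_self_nonneg _
    have h2 : star q * (star k * k) * q ≤ star q * algebraMap ℝ A (‖k‖ ^ 2) * q :=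
      star_left_conjugate_le_conjugate CStarAlgebra.star_mul_le_algebraMap_norm_sq q
    rw [hksa.star_eq, hqs, Algebra.algebraMap_eq_smul_one, mul_smul_comm, mul_one, smul_mul_assoc,
      hqq] at h2
    have h3 : star (t • (1 - q) - k * q) * (t • (1 - q) - k * q) =
        t ^ 2 • (1 - q) - t • k + q * (k * k) * q := by
      have hqkq : q * k * q = 0 := by
        rw [hk, mul_smul_comm, smul_mul_assoc, mul_sub, sub_mul, ← mul_assoc, hqq,
          mul_assoc q (b * q), mul_assoc b, hqq, ← mul_assoc, sub_self, smul_zero]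
      have hkq : k = k * q + q * k := by
        rw [hk, smul_mul_assoc, mul_smul_comm, ← smul_add, sub_mul, mul_sub, ← mul_assoc q q, hqq,
          mul_assoc b, hqq, mul_assoc]
        congr 1
        abel
      have e1 : (1 - q) * (1 - q) = 1 - q := hq.one_sub.isIdempotentElem.eq
      have e2 : (1 - q) * (k * q) = k * q := by rw [sub_mul, one_mul, ← mul_assoc, hqkq, sub_zero]
      have e3 : q * k * (1 - q) = q * k := by rw [mul_sub, mul_one, hqkq, sub_zero]
      rw [star_sub, star_smul, star_sub, star_one, star_mul, hqs, hksa.star_eq, star_trivial,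
        sub_mul, mul_sub, mul_sub, smul_mul_smul_comm, e1, smul_mul_assoc, e2, mul_smul_comm, e3]
      have e4 : t • k = t • (k * q) + t • (q * k) := by rw [← smul_add, ← hkq]
      have e5 : q * (k * k) * q = q * k * (k * q) := by simp only [mul_assoc]
      rw [e4, e5]
      module
    have h4 : 0 ≤ t⁻¹ • (t ^ 2 • (1 - q) - t • k + ‖k‖ ^ 2 • q) :=
      smul_nonneg (by positivity) ((h3 ▸ h1).trans (by gcongr))
    rw [← sub_nonneg]
    convert h4 using 1
    match_scalars <;> field_simp
  refine ⟨ρ + ‖k‖ ^ 2 / t + t, fun z hz l hl hlρ ↦ ?_⟩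
  have hle : algebraMap ℝ A t ≤ l.im • (1 - q) + (z.im - l.im) • q - k := by
    have h1 : t • (1 - q) ≤ (l.im - t) • (1 - q) :=
      smul_le_smul_of_nonneg_right (by linarith) hq.one_sub.nonneg
    have h2 : t • q ≤ (z.im - l.im - ‖k‖ ^ 2 / t) • q :=
      smul_le_smul_of_nonneg_right
        (by linarith [(le_abs_self _).trans ((abs_im_le_norm l).trans hlρ)]) hq.nonneg
    calc algebraMap ℝ A t = t • (1 - q) + t • q := by
          rw [Algebra.algebraMap_eq_smul_one]
          module
      _ ≤ (l.im - t) • (1 - q) + (z.im - l.im - ‖k‖ ^ 2 / t) • q := add_le_add h1 h2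
      _ = l.im • (1 - q) + (z.im - l.im) • q - (t • (1 - q) + (‖k‖ ^ 2 / t) • q) := by module
      _ ≤ l.im • (1 - q) + (z.im - l.im) • q - k := by gcongr
  have hsa : IsSelfAdjoint
      (algebraMap ℝ A l.re - b - (2 * l.re - z.re) • q + (q * b + b * q)) := by
    refine (((IsSelfAdjoint.algebraMap A (.all l.re)).sub hb).sub
      ((IsSelfAdjoint.all _).smul hq.isSelfAdjoint)).add ?_
    rw [IsSelfAdjoint, star_add, star_mul, star_mul, hqs, hb.star_eq, add_comm]
  have hu := isUnit_add_I_smul_of_le hsa ht0 hle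
  have hs : (1 - (2 : ℂ) • q) * (1 - (2 : ℂ) • q) = 1 := by
    rw [mul_sub, mul_one, sub_mul, one_mul, smul_mul_smul_comm, hqq]
    module
  have hsu : IsUnit (1 - (2 : ℂ) • q) := ⟨⟨_, _, hs, hs⟩, rfl⟩
  refine (hsu.mul_left_iff).mp ?_
  convert hu using 1
  have hIk : I • k = b * q - q * b := by
    rw [hk, smul_smul, I_mul_I, neg_one_smul, neg_sub]
  rw [smul_sub, hIk]
  conv_lhs => rw [← re_add_im z, ← re_add_im l]
  simp only [Algebra.algebraMap_eq_smul_one, ← Complex.coe_smul, sub_mul, mul_sub, mul_add,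
    one_mul, smul_mul_assoc, mul_smul_comm, hqq, mul_one]
  push_cast
  module

open Complex in
/-- Under real rank zero, a perturbation `d₁ + I • d₂` of the self-adjoint element `b` that does not
enlarge the spectra of the elements `b + (r * c) • q` has nonpositive imaginary part. -/
theorem nonpos_of_spectrum_subset
    (hrr0 : ∀ a : A, IsSelfAdjoint a → a ∈ closure {x : A | IsSelfAdjoint x ∧ IsUnit x})
    {b d₁ d₂ : A} (hb : IsSelfAdjoint b) (hd₁ : IsSelfAdjoint d₁) (hd₂ : IsSelfAdjoint d₂)
    {c : ℂ} (hc : c.im ≠ 0)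
    (hspec : ∀ q : A, IsStarProjection q → ∀ r : ℝ,
      spectrum ℂ (b + (d₁ + I • d₂) + (r * c) • q) ⊆ spectrum ℂ (b + (r * c) • q)) :
    d₂ ≤ 0 := by
  by_contra hpos
  obtain ⟨ε, hε, q, hq, hq1, r₁, hr₁⟩ := exists_isStarProjection_le_add_smul hrr0 hd₂ hpos
  set w := b + (d₁ + I • d₂) with hw
  obtain ⟨r₂, hr₂⟩ := isUnit_algebraMap_sub_of_le_im hb hq (ρ := 8 * ‖w‖ + 1) (half_pos hε)
  set R : ℝ := max (max r₁ r₂) (2 * (8 * ‖w‖ + 1)) with hR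
  have hR1 : r₁ ≤ R := (le_max_left _ _).trans (le_max_left _ _)
  have hR2 : r₂ ≤ R := (le_max_right _ _).trans (le_max_left _ _)
  set z : ℂ := (R / c.im : ℝ) * c with hz
  have hzim : z.im = R := by
    rw [hz, im_ofReal_mul]
    field_simp
  obtain ⟨l, hl, hlρ⟩ := exists_mem_spectrum_add_smul_projection hq hq1 w (z := z)
    ((le_max_right _ _).trans (hzim ▸ (le_abs_self _).trans (abs_im_le_norm z)))
  have hlim : ε / 2 ≤ l.im := by
    by_contra! hlt
    refine hl ?_
    have hle : algebraMap ℝ A (ε / 2) ≤ d₂ + R • q - algebraMap ℝ A l.im := by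
      refine le_sub_iff_add_le.mpr ?_
      rw [← map_add]
      exact (algebraMap_mono A (by linarith)).trans (hr₁ R hR1)
    have hsa : IsSelfAdjoint (b + d₁ + z.re • q - algebraMap ℝ A l.re) :=
      ((hb.add hd₁).add ((IsSelfAdjoint.all z.re).smul hq.isSelfAdjoint)).sub
        (IsSelfAdjoint.algebraMap A (.all l.re))
    have := isUnit_add_I_smul_of_le hsa (half_pos hε) hle
    rw [spectrum.mem_resolventSet_iff, ← IsUnit.neg_iff]
    convert this using 1
    rw [hw, ← hzim]
    conv_lhs => rw [← re_add_im z, ← re_add_im l]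
    simp only [Algebra.algebraMap_eq_smul_one, ← Complex.coe_smul]
    module
  refine hspec q hq (R / c.im) hl ?_
  exact hr₂ z (hzim ▸ hR2) l hlim hlρ

open Complex in
/-- Under real rank zero, if `σ(a + ib + e) ⊆ σ(a + ib)` for every self-adjoint `a`, then `e = 0`. -/
theorem eq_zero_of_spectrum_subset
    (hrr0 : ∀ a : A, IsSelfAdjoint a → a ∈ closure {x : A | IsSelfAdjoint x ∧ IsUnit x})
    {b e : A} (hb : IsSelfAdjoint b)
    (hspec : ∀ a : A, IsSelfAdjoint a → spectrum ℂ (a + I • b + e) ⊆ spectrum ℂ (a + I • b)) :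
    e = 0 := by
  have key : ∀ κ : ℝ, ∀ c : ℂ, c * (κ + I) = 1 → c.im ≠ 0 → ∀ d₁ d₂ : A, IsSelfAdjoint d₁ →
      IsSelfAdjoint d₂ → d₁ + I • d₂ = c • e → d₂ = 0 := by
    intro κ c hc hcim d₁ d₂ hd₁ hd₂ hd
    have hc0 : c ≠ 0 := left_ne_zero_of_mul_eq_one hc
    have hsub : ∀ u : ℂˣ, ∀ q : A, IsStarProjection q → ∀ r : ℝ,
        spectrum ℂ (((u : ℂ) * c) • (κ • b + r • q + I • b + e)) ⊆
          spectrum ℂ (((u : ℂ) * c) • (κ • b + r • q + I • b)) := by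
      intro u q hq r
      have h := hspec (κ • b + r • q) (((IsSelfAdjoint.all κ).smul hb).add
        ((IsSelfAdjoint.all r).smul hq.isSelfAdjoint))
      have e1 := fun x : A ↦ spectrum.unit_smul_eq_smul x (u * Units.mk0 c hc0)
      simp only [Units.smul_def, Units.val_mul, Units.val_mk0] at e1
      rw [e1, e1]
      exact Set.smul_set_mono h
    have hcb : ∀ (q : A) (r : ℝ), b + ((r : ℂ) * c) • q = c • (κ • b + r • q + I • b) := by
      intro q r
      have : b = (c * (κ + I)) • b := by rw [hc, one_smul]
      conv_lhs => rw [this]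
      simp only [← Complex.coe_smul]
      module
    refine le_antisymm (nonpos_of_spectrum_subset hrr0 hb hd₁ hd₂ hcim fun q hq r ↦ ?_)
      (neg_nonpos.mp (nonpos_of_spectrum_subset hrr0 hb.neg hd₁.neg hd₂.neg hcim fun q hq r ↦ ?_))
    · convert hsub 1 q hq r using 2
      · rw [add_right_comm, hcb, hd, Units.val_one, one_mul, ← smul_add]
      · rw [hcb, Units.val_one, one_mul]
    · have hneg : -b + ((r : ℂ) * c) • q = -(b + (((-r : ℝ) : ℂ) * c) • q) := by
        push_cast
        module
      convert hsub (-1) q hq (-r) using 2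
      · rw [smul_neg, ← neg_add, hd, add_right_comm, hneg, hcb, Units.val_neg, Units.val_one,
          smul_add]
        module
      · rw [hneg, hcb, Units.val_neg, Units.val_one]
        module
  have hre : ((realPart e : selfAdjoint A) : A) = 0 := by
    refine neg_eq_zero.mp (key 0 (-I) (by simp) (by simp) (imaginaryPart e : A) _
      (imaginaryPart e).2 (realPart e).2.neg ?_)
    conv_rhs => rw [← realPart_add_I_smul_imaginaryPart e]
    rw [smul_add, smul_smul]
    simp [add_comm]
  have him : ((imaginaryPart e : selfAdjoint A) : A) = 0 := by
    have h2 := key 1 ((1 - I) / 2) (by ring_nf; simp; norm_num) (by simp)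
      ((2⁻¹ : ℝ) • (imaginaryPart e : A)) ((2⁻¹ : ℝ) • (imaginaryPart e : A))
      ((IsSelfAdjoint.all _).smul (imaginaryPart e).2)
      ((IsSelfAdjoint.all _).smul (imaginaryPart e).2) (by
        conv_rhs => rw [← realPart_add_I_smul_imaginaryPart e, hre, zero_add]
        simp only [← Complex.coe_smul]
        match_scalars
        ring_nf
        simp
        ring)
    exact (smul_eq_zero.mp h2).resolve_left (by norm_num)
  rw [← realPart_add_I_smul_imaginaryPart e, hre, him, smul_zero, add_zero]

end CStar

section Jordan

variable {A B : Type*} [Ring A] [Algebra ℂ A] [Ring B] [Algebra ℂ B]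

theorem LinearMap.map_mul_mul_of_map_mul_self (S : A →ₗ[ℂ] B)
    (hS : ∀ x : A, S (x * x) = S x * S x) (x y : A) : S (x * y * x) = S x * S y * S x := by
  have hS2 : ∀ x y : A, S (x * y + y * x) = S x * S y + S y * S x := fun x y ↦ by
    have h := hS (x + y)
    simp only [add_mul, mul_add, map_add, hS] at h ⊢
    rw [← sub_eq_zero] at h ⊢
    rw [← h]
    abel
  have h1 := hS2 x (x * y + y * x)
  have h2 := hS2 (x * x) y
  have h3 : (2 : ℂ) • (x * y * x) =
      (x * (x * y + y * x) + (x * y + y * x) * x) - (x * x * y + y * (x * x)) := by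
    rw [two_smul]
    noncomm_ring
  have h4 : (2 : ℂ) • S (x * y * x) = (2 : ℂ) • (S x * S y * S x) := by
    rw [← map_smul, h3, map_sub, h1, h2, hS2, hS, two_smul]
    noncomm_ring
  exact smul_right_injective B two_ne_zero h4

theorem LinearMap.isUnit_map_of_map_mul_self (S : A →ₗ[ℂ] B) (hS1 : S 1 = 1)
    (hS : ∀ x : A, S (x * x) = S x * S x) {x : A} (hx : IsUnit x) : IsUnit (S x) := by
  obtain ⟨u, rfl⟩ := hx
  have h : S u * S (↑u⁻¹ * ↑u⁻¹) * S u = 1 := by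
    rw [← S.map_mul_mul_of_map_mul_self hS, ← hS1]
    simp
  exact isUnit_iff_exists_and_exists.mpr
    ⟨⟨_, by rwa [mul_assoc] at h⟩, ⟨_, h⟩⟩

/-- A unital Jordan homomorphism does not enlarge spectra. -/
theorem LinearMap.spectrum_map_subset_of_map_mul_self (S : A →ₗ[ℂ] B) (hS1 : S 1 = 1)
    (hS : ∀ x : A, S (x * x) = S x * S x) (x : A) : spectrum ℂ (S x) ⊆ spectrum ℂ x := by
  intro l hl hx
  refine hl ?_
  have := S.isUnit_map_of_map_mul_self hS1 hS hx
  rwa [Algebra.algebraMap_eq_smul_one, map_sub, map_smul, hS1,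
    ← Algebra.algebraMap_eq_smul_one] at this

end Jordan


/-- With `T`, `S`, `R` as in the paper (`R = T⁻¹ ∘ S`), one has
`(Rx + i·R(ix))² = 0` for every `x ∈ A`. -/
theorem square_zero_of_R_combination
    {A : Type*} [NormedRing A] [StarRing A] [CStarRing A] [NormedAlgebra ℂ A]
    [CompleteSpace A] [StarModule ℂ A]
    (hrr0 : ∀ a : A, IsSelfAdjoint a → a ∈ closure {x : A | IsSelfAdjoint x ∧ IsUnit x})
    {B : Type*} [NormedRing B] [NormedAlgebra ℂ B] [CompleteSpace B]
    (T : A → B)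
    (hsurj : Function.Surjective T)
    (hadd : ∀ x y : A, T (x + y) = T x + T y)
    (hspec : ∀ x : A, spectrum ℂ (T x) = spectrum ℂ x)
    (S : A →ₗ[ℂ] B) (hS1 : S 1 = 1) (hSj : ∀ x : A, S (x * x) = S x * S x)
    (hST : ∀ a : A, IsSelfAdjoint a → S a = T a)
    (R : A → A) (hR : ∀ x : A, T (R x) = S x) :
    ∀ x : A,
      (R x + Complex.I • R (Complex.I • x)) * (R x + Complex.I • R (Complex.I • x)) = 0 := by
  let _ : CStarAlgebra A := {}
  let _ : PartialOrder A := CStarAlgebra.spectralOrder A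
  have : StarOrderedRing A := CStarAlgebra.spectralOrderedRing A
  have hT_I : ∀ b : A, IsSelfAdjoint b → T (Complex.I • b) = S (Complex.I • b) := fun b hb ↦ by
    have h : R (Complex.I • b) - Complex.I • b = 0 :=
      eq_zero_of_spectrum_subset hrr0 hb fun a ha ↦ by
        rw [add_assoc, add_sub_cancel, ← hspec, hadd, hR, ← hST a ha, ← map_add]
        exact S.spectrum_map_subset_of_map_mul_self hS1 hSj _
    rw [← hR, sub_eq_zero.mp h]
  have hTS : ∀ x : A, T x = S x := fun x ↦ by
    rw [← realPart_add_I_smul_imaginaryPart x, hadd, map_add, hT_I _ (imaginaryPart x).2,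
      hST _ (realPart x).2]
  have hRid : ∀ x : A, R x = x := fun x ↦ by
    have hT0 : T (R x - x) = 0 := by rw [hTS, map_sub, ← hTS, hR, sub_self]
    refine sub_eq_zero.mp (eq_zero_of_spectrum_subset hrr0 (b := 0) (.zero A) fun a _ ↦ ?_)
    rw [smul_zero, add_zero, ← hspec, hadd, hT0, add_zero, hspec]
  intro x
  rw [hRid, hRid, smul_smul, Complex.I_mul_I, neg_one_smul, add_neg_cancel, zero_mul]
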